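/- For every k ≥ 1 one has R^{∧k,∧1}(u) = R_{∧k,∧1}(u) · ∏_{i=1}^{k−1} (u − i) and R^{∧1,∧k}(u) = R_{∧1,∧k}(u) · ∏_{i=0}^{k−2} (u + i), as identities of operators (on V^{∧k} ⊗ V and V ⊗ V^{∧k} respectively) depending polynomially on u. -/

import Mathlib

noncomputable section
namespace Paper

def parN (m : ℕ) (c : ℕ) : ℕ := if c < m then 0 else 1
def par (m : ℕ) {N : ℕ} (a : Fin N) : ℕ := parN m a

variable {R : Type} [Ring R] {ι : Type} [Fintype ι] [DecidableEq ι] {N : ℕ}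

def mpar (m : ℕ) (r : ι → Fin N) : ℕ := ∑ v, par m (r v)

def invExp (m : ℕ) (lt : ι → ι → Prop) [DecidableRel lt] (σ : Equiv.Perm ι)
    (s : ι → Fin N) : ℕ :=
  ∑ p ∈ Finset.univ.filter (fun p : ι × ι => lt p.1 p.2 ∧ lt (σ p.2) (σ p.1)),
    par m (s p.1) * par m (s p.2)

def permMat (m : ℕ) (lt : ι → ι → Prop) [DecidableRel lt] (σ : Equiv.Perm ι) :
    Matrix (ι → Fin N) (ι → Fin N) R := fun r s =>
  if r = s ∘ σ.symm then (-1 : R) ^ invExp m lt σ s else 0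

def embed (m : ℕ) (lt : ι → ι → Prop) [DecidableRel lt] (v : ι) (f : Fin N → Fin N → R) :
    Matrix (ι → Fin N) (ι → Fin N) R := fun r s =>
  if ∀ w, w ≠ v → r w = s w then
    ((-1 : R) ^ ((par m (r v) + par m (s v)) *
        ∑ w ∈ Finset.univ.filter (fun w => lt w v), par m (s w))) * f (r v) (s v)
  else 0

/-- The matrix unit `E_{ab}`. -/
def Eunit {N : ℕ} (a b : Fin N) : Fin N → Fin N → ℂ := fun c d => if c = a ∧ d = b then 1 else 0

/-- The rational R-matrix `R^{(ij)}(u) = u + P^{(ij)}` in factors `i, j` of `V^{⊗k}`. -/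
def RMat (m : ℕ) {N : ℕ} {k : ℕ} (i j : Fin k) (u : ℂ) :
    Matrix (Fin k → Fin N) (Fin k → Fin N) ℂ :=
  u • 1 + permMat m (· < ·) (Equiv.swap i j)

/-- `R^{∧k,∧l}(u)` before restriction:
`←∏_{1≤i≤k} →∏_{1≤j≤l} R^{(i,j+k)}(u+i-j-k+l)` on `V^{⊗(k+l)}`. -/
def fusedR (m : ℕ) (N k l : ℕ) (u : ℂ) :
    Matrix (Fin (k + l) → Fin N) (Fin (k + l) → Fin N) ℂ :=
  (((List.finRange k).reverse).map fun i =>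
    (((List.finRange l)).map fun j =>
      RMat m (Fin.castAdd l i) (Fin.natAdd k j)
        (u + (i : ℕ) - (j : ℕ) - (k : ℕ) + (l : ℕ))).prod).prod

/-- Extension of a permutation of the first `k` factors to all `k+l` factors. -/
def extL {k l : ℕ} (σ : Equiv.Perm (Fin k)) : Equiv.Perm (Fin (k + l)) :=
  finSumFinEquiv.symm.trans ((Equiv.sumCongr σ (Equiv.refl (Fin l))).trans finSumFinEquiv)

/-- Extension of a permutation of the last `l` factors to all `k+l` factors. -/
def extR {k l : ℕ} (σ : Equiv.Perm (Fin l)) : Equiv.Perm (Fin (k + l)) :=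
  finSumFinEquiv.symm.trans ((Equiv.sumCongr (Equiv.refl (Fin k)) σ).trans finSumFinEquiv)

/-- Antisymmetrizer of the first `k` factors of `V^{⊗(k+l)}` (projection onto `V^{∧k} ⊗ V^{⊗l}`). -/
def projAL (m : ℕ) (N k l : ℕ) : Matrix (Fin (k + l) → Fin N) (Fin (k + l) → Fin N) ℂ :=
  ((k.factorial : ℂ))⁻¹ •
    ∑ σ : Equiv.Perm (Fin k), (((Equiv.Perm.sign σ : ℤ) : ℂ)) • permMat m (· < ·) (extL σ)

/-- Antisymmetrizer of the last `l` factors of `V^{⊗(k+l)}`. -/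
def projAR (m : ℕ) (N k l : ℕ) : Matrix (Fin (k + l) → Fin N) (Fin (k + l) → Fin N) ℂ :=
  ((l.factorial : ℂ))⁻¹ •
    ∑ σ : Equiv.Perm (Fin l), (((Equiv.Perm.sign σ : ℤ) : ℂ)) • permMat m (· < ·) (extR σ)

/-- `R_{∧k,∧1}(u) = u + Σ_{a,b,i} E_{ab}^{(i)} ⊗ (-1)^{|b|} E_{ba}` on `V^{⊗k} ⊗ V`. -/
def Rdown (m : ℕ) (N k : ℕ) (u : ℂ) :
    Matrix (Fin (k + 1) → Fin N) (Fin (k + 1) → Fin N) ℂ :=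
  u • 1 + ∑ a : Fin N, ∑ b : Fin N, ∑ i : Fin k,
    ((-1 : ℂ) ^ par m b) •
      (embed m (· < ·) (Fin.castAdd 1 i) (Eunit a b) *
        embed m (· < ·) (Fin.natAdd k (0 : Fin 1)) (Eunit b a))

/-- `R_{∧1,∧k}(u) = u + k - 1 + Σ_{a,b,i} (-1)^{|b|} E_{ab} ⊗ E_{ba}^{(i)}` on `V ⊗ V^{⊗k}`. -/
def Rup (m : ℕ) (N k : ℕ) (u : ℂ) :
    Matrix (Fin (1 + k) → Fin N) (Fin (1 + k) → Fin N) ℂ :=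
  (u + (k : ℂ) - 1) • 1 + ∑ a : Fin N, ∑ b : Fin N, ∑ i : Fin k,
    ((-1 : ℂ) ^ par m b) •
      (embed m (· < ·) (Fin.castAdd k (0 : Fin 1)) (Eunit a b) *
        embed m (· < ·) (Fin.natAdd 1 i) (Eunit b a))

theorem sum_lt_pairs_comp_perm {ι M : Type*} [Fintype ι] [LinearOrder ι] [AddCommMonoid M]
    (h : ι → ι → M) (hsymm : ∀ x y, h x y = h y x) (τ : Equiv.Perm ι) :
    ∑ p ∈ Finset.univ.filter (fun p : ι × ι => p.1 < p.2), h (τ p.1) (τ p.2)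
      = ∑ p ∈ Finset.univ.filter (fun p : ι × ι => p.1 < p.2), h p.1 p.2 := by
  refine Finset.sum_nbij' (fun p => (min (τ p.1) (τ p.2), max (τ p.1) (τ p.2)))
    (fun p => (min (τ.symm p.1) (τ.symm p.2), max (τ.symm p.1) (τ.symm p.2))) ?_ ?_ ?_ ?_ ?_
  · rintro ⟨x, y⟩ hxy
    have h' : x < y := by simpa using hxy
    simpa using h'.ne'
  · rintro ⟨x, y⟩ hxy
    have h' : x < y := by simpa using hxy
    simpa using h'.ne'
  · rintro ⟨x, y⟩ hxy
    have hlt : x < y := by simpa using hxy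
    rcases le_total (τ x) (τ y) with h' | h' <;> simp [h', hlt.le]
  · rintro ⟨x, y⟩ hxy
    have hlt : x < y := by simpa using hxy
    rcases le_total (τ.symm x) (τ.symm y) with h' | h' <;> simp [h', hlt.le]
  · rintro ⟨x, y⟩ -
    rcases le_total (τ x) (τ y) with h' | h' <;> simp [h', hsymm (τ y)]

theorem neg_one_pow_invExp_mul {ι : Type} [Fintype ι] [LinearOrder ι] {N : ℕ} (m : ℕ)
    (σ τ : Equiv.Perm ι) (s : ι → Fin N) :
    (-1 : ℂ) ^ invExp m (· < ·) (σ * τ) s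
      = (-1) ^ invExp m (· < ·) σ (s ∘ τ.symm) * (-1) ^ invExp m (· < ·) τ s := by
  classical
  let g : ι → ι → ℕ := fun x y =>
    if (x < y ↔ σ y < σ x) then par m (s (τ.symm x)) * par m (s (τ.symm y)) else 0
  have key : invExp m (· < ·) σ (s ∘ τ.symm)
      = ∑ p ∈ Finset.univ.filter (fun p : ι × ι => p.1 < p.2),
        if σ (τ p.1) = σ (τ p.2) then 0 else g (τ p.1) (τ p.2) := by
    rw [sum_lt_pairs_comp_perm (fun x y => if σ x = σ y then 0 else g x y)]
    · rw [invExp, ← Finset.filter_filter, Finset.sum_filter]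
      refine Finset.sum_congr rfl fun p hp => ?_
      have hp' : p.1 < p.2 := by simpa using hp
      simp [g, hp', hp'.ne]
    · intro x y
      by_cases hxy : x = y
      · simp [hxy]
      · have h1 : σ x ≠ σ y := by simpa using hxy
        have : (x < y ↔ σ y < σ x) ↔ (y < x ↔ σ x < σ y) := by
          rcases lt_or_gt_of_ne hxy with h | h <;> rcases lt_or_gt_of_ne h1 with h' | h' <;>
            simp [h, h', h.not_gt, h'.not_gt]
        simp [g, h1, h1.symm, this, mul_comm]
  rw [key, invExp, invExp, ← Finset.filter_filter, ← Finset.filter_filter, Finset.sum_filter,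
    Finset.sum_filter (p := fun a : ι × ι => τ a.2 < τ a.1), ← Finset.prod_pow_eq_pow_sum,
    ← Finset.prod_pow_eq_pow_sum, ← Finset.prod_pow_eq_pow_sum, ← Finset.prod_mul_distrib]
  refine Finset.prod_congr rfl fun p hp => ?_
  have hp' : p.1 ≠ p.2 := (by simpa using hp : p.1 < p.2).ne
  have h1 : τ p.1 ≠ τ p.2 := by simpa using hp'
  have h2 : σ (τ p.1) ≠ σ (τ p.2) := by simpa using hp'
  have hsq : ((-1 : ℂ) ^ (par m (s p.1) * par m (s p.2)))
      * (-1) ^ (par m (s p.1) * par m (s p.2)) = 1 := by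
    rw [← mul_pow]; simp
  rcases lt_or_gt_of_ne h1 with h | h <;> rcases lt_or_gt_of_ne h2 with h' | h' <;>
    simp [g, h, h', h2, h.not_gt, h'.not_gt, hsq]

theorem permMat_mul {ι : Type} [Fintype ι] [LinearOrder ι] {N : ℕ} (m : ℕ)
    (σ τ : Equiv.Perm ι) :
    (permMat m (· < ·) (σ * τ) : Matrix (ι → Fin N) (ι → Fin N) ℂ)
      = permMat m (· < ·) σ * permMat m (· < ·) τ := by
  ext r s
  rw [Matrix.mul_apply, Finset.sum_eq_single (s ∘ τ.symm)]
  · have : s ∘ (σ * τ).symm = (s ∘ τ.symm) ∘ σ.symm := rfl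
    simp only [permMat, this, neg_one_pow_invExp_mul]
    split_ifs <;> simp
  · intro t _ ht
    simp [permMat, ht]
  · simp

theorem extL_mul {k l : ℕ} (σ τ : Equiv.Perm (Fin k)) :
    (extL (σ * τ) : Equiv.Perm (Fin (k + l))) = extL σ * extL τ := by
  ext x
  refine Fin.addCases (fun i => ?_) (fun i => ?_) x <;> simp [extL]

theorem extR_mul {k l : ℕ} (σ τ : Equiv.Perm (Fin l)) :
    (extR (σ * τ) : Equiv.Perm (Fin (k + l))) = extR σ * extR τ := by
  ext x
  refine Fin.addCases (fun i => ?_) (fun i => ?_) x <;> simp [extR]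

theorem extL_swap {k l : ℕ} (i j : Fin k) :
    (extL (Equiv.swap i j) : Equiv.Perm (Fin (k + l)))
      = Equiv.swap (Fin.castAdd l i) (Fin.castAdd l j) := by
  ext x
  refine Fin.addCases (fun a => ?_) (fun a => ?_) x
  · simp only [extL, Equiv.swap_apply_def, Equiv.trans_apply, finSumFinEquiv_symm_apply_castAdd,
      Equiv.sumCongr_apply, Sum.map_inl, finSumFinEquiv_apply_left, Fin.castAdd_inj]
    split_ifs <;> rfl
  · rw [Equiv.swap_apply_of_ne_of_ne (by simp [Fin.ext_iff]; omega) (by simp [Fin.ext_iff]; omega)]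
    simp only [extL, Equiv.trans_apply, finSumFinEquiv_symm_apply_natAdd,
      Equiv.sumCongr_apply, Sum.map_inr, finSumFinEquiv_apply_right, Equiv.refl_apply]

theorem extR_swap {k l : ℕ} (i j : Fin l) :
    (extR (Equiv.swap i j) : Equiv.Perm (Fin (k + l)))
      = Equiv.swap (Fin.natAdd k i) (Fin.natAdd k j) := by
  ext x
  refine Fin.addCases (fun a => ?_) (fun a => ?_) x
  · rw [Equiv.swap_apply_of_ne_of_ne (by simp [Fin.ext_iff]; omega) (by simp [Fin.ext_iff]; omega)]
    simp only [extR, Equiv.trans_apply, finSumFinEquiv_symm_apply_castAdd,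
      Equiv.sumCongr_apply, Sum.map_inl, finSumFinEquiv_apply_left, Equiv.refl_apply]
  · simp only [extR, Equiv.swap_apply_def, Equiv.trans_apply, finSumFinEquiv_symm_apply_natAdd,
      Equiv.sumCongr_apply, Sum.map_inr, finSumFinEquiv_apply_right, Fin.natAdd_inj]
    split_ifs <;> rfl

theorem mul_antisymmetrizer {α M : Type*} [Fintype α] [DecidableEq α] [Ring M] [Algebra ℂ M]
    (ρ : Equiv.Perm α → M) (hρ : ∀ σ τ, ρ (σ * τ) = ρ σ * ρ τ) (c : ℂ) (τ : Equiv.Perm α) :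
    ρ τ * (c • ∑ σ : Equiv.Perm α, ((Equiv.Perm.sign σ : ℤ) : ℂ) • ρ σ)
      = ((Equiv.Perm.sign τ : ℤ) : ℂ) •
        (c • ∑ σ : Equiv.Perm α, ((Equiv.Perm.sign σ : ℤ) : ℂ) • ρ σ) := by
  rw [mul_smul_comm, smul_comm _ c]
  congr 1
  rw [Finset.mul_sum, Finset.smul_sum]
  refine Fintype.sum_equiv (Equiv.mulLeft τ) _ _ fun σ => ?_
  have h : ((Equiv.Perm.sign τ : ℤ) : ℂ) * ((Equiv.Perm.sign τ : ℤ) : ℂ) = 1 := by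
    rw [← Int.cast_mul, ← Units.val_mul]; simp
  simp only [Equiv.coe_mulLeft, hρ, mul_smul_comm, Equiv.Perm.sign_mul, Units.val_mul,
    Int.cast_mul, smul_smul, ← mul_assoc, h, one_mul]

theorem permMat_swap_mul_projAL (m N : ℕ) {k l : ℕ} {i j : Fin k} (hij : i ≠ j) :
    permMat m (· < ·) (Equiv.swap (Fin.castAdd l i) (Fin.castAdd l j)) * projAL m N k l
      = -projAL m N k l := by
  have := mul_antisymmetrizer
    (fun σ : Equiv.Perm (Fin k) =>
      (permMat m (· < ·) (extL σ) : Matrix (Fin (k + l) → Fin N) (Fin (k + l) → Fin N) ℂ))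
    (fun σ τ => by simp only [extL_mul, permMat_mul]) ((k.factorial : ℂ))⁻¹ (Equiv.swap i j)
  simpa [extL_swap, Equiv.Perm.sign_swap hij, projAL] using this

theorem permMat_swap_mul_projAR (m N : ℕ) {k l : ℕ} {i j : Fin l} (hij : i ≠ j) :
    permMat m (· < ·) (Equiv.swap (Fin.natAdd k i) (Fin.natAdd k j)) * projAR m N k l
      = -projAR m N k l := by
  have := mul_antisymmetrizer
    (fun σ : Equiv.Perm (Fin l) =>
      (permMat m (· < ·) (extR σ) : Matrix (Fin (k + l) → Fin N) (Fin (k + l) → Fin N) ℂ))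
    (fun σ τ => by simp only [extR_mul, permMat_mul]) ((l.factorial : ℂ))⁻¹ (Equiv.swap i j)
  simpa [extR_swap, Equiv.Perm.sign_swap hij, projAR] using this

/-- Transpositions `(i, c)`, `(j, c)` with a common point, applied to anything antisymmetric
under `(i, j)`. -/
theorem permMat_swap_mul_swap_mul {ι : Type} [Fintype ι] [LinearOrder ι] {N m : ℕ}
    {i j c : ι} (hij : i ≠ j) (hjc : j ≠ c) {A : Matrix (ι → Fin N) (ι → Fin N) ℂ}
    (hA : permMat m (· < ·) (Equiv.swap i j) * A = -A) :
    permMat m (· < ·) (Equiv.swap j c) * (permMat m (· < ·) (Equiv.swap i c) * A)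
      = -(permMat m (· < ·) (Equiv.swap i c) * A) := by
  have h : Equiv.swap j c * Equiv.swap i c = Equiv.swap i c * Equiv.swap i j := by
    have := Equiv.mul_swap_eq_swap_mul (Equiv.swap i c) i j
    rw [this, Equiv.swap_apply_left, Equiv.swap_apply_of_ne_of_ne hij.symm hjc, Equiv.swap_comm]
  rw [← Matrix.mul_assoc, ← permMat_mul, h, permMat_mul, Matrix.mul_assoc, hA, Matrix.mul_neg]

/-- The fusion identity, in terms of operators `P i` with `P i P j A = - P j A`. -/
theorem prod_smul_one_add_mul {M : Type*} [Ring M] [Algebra ℂ M] (A : M) (v : ℂ) :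
    ∀ (k : ℕ) (P : Fin (k + 1) → M), (∀ i j, i ≠ j → P i * (P j * A) = -(P j * A)) →
      ((List.finRange (k + 1)).map fun i : Fin (k + 1) =>
          (v + ((k : ℂ) - (i : ℕ))) • (1 : M) + P i).prod * A
        = (∏ t ∈ Finset.range k, (v + t)) • (((v + k) • (1 : M) + ∑ i, P i) * A)
  | 0, P, _ => by simp [List.finRange_succ]
  | k + 1, P, hP => by
    have ih := prod_smul_one_add_mul A v k (fun i => P i.succ)
      (fun i j hij => hP _ _ (by simpa using hij))
    have hshift : ∀ i : Fin (k + 1),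
        v + (((k + 1 : ℕ) : ℂ) - ((i.succ : Fin (k + 2)) : ℕ)) = v + ((k : ℂ) - (i : ℕ)) := by
      intro i; push_cast [Fin.val_succ]; ring
    have hsum : P 0 * ((∑ i : Fin (k + 1), P i.succ) * A)
        = -((∑ i : Fin (k + 1), P i.succ) * A) := by
      rw [Finset.sum_mul, Finset.mul_sum, ← Finset.sum_neg_distrib]
      exact Finset.sum_congr rfl fun i _ => hP _ _ (Fin.succ_ne_zero i).symm
    rw [List.finRange_succ, List.map_cons, List.prod_cons, List.map_map, mul_assoc]
    simp only [Function.comp_def, hshift]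
    rw [ih, Finset.prod_range_succ, Fin.sum_univ_succ P, mul_smul_comm, mul_smul]
    congr 1
    simp only [add_mul, mul_add, smul_mul_assoc, one_mul, mul_smul_comm, hsum]
    push_cast [Fin.val_zero]
    module

theorem invExp_swap (m : ℕ) {N k : ℕ} {p q : Fin k} (hpq : p < q) (s : Fin k → Fin N) :
    invExp m (· < ·) (Equiv.swap p q) s
      = par m (s p) * par m (s q)
        + (par m (s p) + par m (s q)) * ∑ w ∈ Finset.Ioo p q, par m (s w) := by
  have h : Finset.univ.filter (fun x : Fin k × Fin k =>
        x.1 < x.2 ∧ Equiv.swap p q x.2 < Equiv.swap p q x.1)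
      = insert (p, q) ((Finset.Ioo p q).image (fun w => (p, w))
        ∪ (Finset.Ioo p q).image (fun w => (w, q))) := by
    ext ⟨x, y⟩
    simp only [Finset.mem_filter, Finset.mem_univ, true_and, Finset.mem_insert, Finset.mem_union,
      Finset.mem_image, Finset.mem_Ioo, Prod.mk.injEq]
    simp only [Equiv.swap_apply_def]
    constructor
    · rintro ⟨h1, h2⟩
      split_ifs at h2 <;> grind
    · rintro (⟨rfl, rfl⟩ | ⟨w, hw, rfl, rfl⟩ | ⟨w, hw, rfl, rfl⟩) <;> grind
  rw [invExp, h, Finset.sum_insert (by simp), Finset.sum_union, Finset.sum_image (by simp),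
    Finset.sum_image (by simp)]
  · simp only [← Finset.mul_sum, ← Finset.sum_mul]
    ring
  · rw [Finset.disjoint_left]
    simp only [Finset.mem_image, Finset.mem_Ioo]
    rintro _ ⟨w, hw, rfl⟩ ⟨w', hw', h'⟩
    simp only [Prod.mk.injEq] at h'
    exact hw'.1.ne' h'.1

theorem embed_Eunit_apply (m : ℕ) {N k : ℕ} (v : Fin k) (a b : Fin N) (r s : Fin k → Fin N) :
    embed m (· < ·) v (Eunit a b) r s
      = if s v = b ∧ r = Function.update s v a then
          (-1 : ℂ) ^ ((par m a + par m b) * ∑ w ∈ Finset.Iio v, par m (s w)) else 0 := by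
  have hIio : Finset.univ.filter (fun w => w < v) = Finset.Iio v := by ext; simp
  by_cases h : s v = b ∧ r = Function.update s v a
  · obtain ⟨rfl, rfl⟩ := h
    rw [embed, if_pos (fun w hw => by simp [hw])]
    simp [Eunit, hIio]
  · rw [if_neg h, embed]
    split_ifs with h'
    · have : ¬ (r v = a ∧ s v = b) := by
        rintro ⟨rfl, h2⟩
        refine h ⟨h2, ?_⟩
        ext w
        by_cases hw : w = v
        · subst hw; simp
        · simp [hw, h' w hw]
      simp [Eunit, this]
    · rfl

theorem sum_embed_mul_embed (m : ℕ) {N k : ℕ} {p q : Fin k} (hpq : p < q) :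
    ∑ a : Fin N, ∑ b : Fin N, ((-1 : ℂ) ^ par m b) •
        (embed m (· < ·) p (Eunit a b) * embed m (· < ·) q (Eunit b a))
      = permMat m (· < ·) (Equiv.swap p q) := by
  ext r s
  have hIio : ∑ w ∈ Finset.Iio q, par m (s w) = ∑ w ∈ Finset.Iio p, par m (s w)
      + (par m (s p) + ∑ w ∈ Finset.Ioo p q, par m (s w)) := by
    have : Finset.Iio q = Finset.Iio p ∪ (insert p (Finset.Ioo p q)) := by
      ext w; simp only [Finset.mem_Iio, Finset.mem_union, Finset.mem_insert, Finset.mem_Ioo]; omega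
    rw [this, Finset.sum_union, Finset.sum_insert (by simp)]
    rw [Finset.disjoint_left]
    intro w
    simp only [Finset.mem_Iio, Finset.mem_insert, Finset.mem_Ioo]; omega
  have hentry : ∀ a b, (embed m (· < ·) p (Eunit a b) * embed m (· < ·) q (Eunit b a)) r s
      = if s q = a then if s p = b then
          embed m (· < ·) p (Eunit a b) r (Function.update s q b)
            * (-1 : ℂ) ^ ((par m b + par m a) * ∑ w ∈ Finset.Iio q, par m (s w)) else 0 else 0 := by
    intro a b
    rw [Matrix.mul_apply, Finset.sum_eq_single (Function.update s q b)]
    · rw [embed_Eunit_apply m q]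
      split_ifs with h1 h2 h3
      · rfl
      · rw [embed_Eunit_apply m p, if_neg (by simp [hpq.ne, h3]), zero_mul]
      all_goals simp_all
    · intro t _ ht
      rw [embed_Eunit_apply m q, if_neg (by simp [ht]), mul_zero]
    · simp
  have hcomp : Function.update (Function.update s q (s p)) p (s q)
      = s ∘ (Equiv.swap p q).symm := by
    ext w
    simp only [Function.update_apply, Function.comp_apply, Equiv.symm_swap, Equiv.swap_apply_def]
    split_ifs <;> rfl
  have hlow : ∑ w ∈ Finset.Iio p, par m (Function.update s q (s p) w)
      = ∑ w ∈ Finset.Iio p, par m (s w) :=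
    Finset.sum_congr rfl fun w hw => by
      rw [Function.update_of_ne ((Finset.mem_Iio.1 hw).trans hpq).ne]
  simp only [Matrix.sum_apply, Matrix.smul_apply, hentry, smul_eq_mul, mul_ite, mul_zero,
    Finset.sum_ite_eq, Finset.mem_univ, if_true, Finset.sum_ite_irrel, Finset.sum_const_zero]
  rw [embed_Eunit_apply, hcomp, permMat, Function.update_of_ne hpq.ne]
  simp only [true_and]
  split_ifs
  · rw [hlow, hIio, invExp_swap m hpq, ← pow_add, ← pow_add]
    generalize ∑ w ∈ Finset.Iio p, par m (s w) = x
    generalize ∑ w ∈ Finset.Ioo p q, par m (s w) = y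
    generalize par m (s q) = a
    have hb : par m (s p) * par m (s p) = par m (s p) := by
      unfold par parN; split_ifs <;> rfl
    generalize par m (s p) = b at hb ⊢
    have : b + ((a + b) * x + (b + a) * (x + (b + y)))
        = 2 * ((a + b) * x + b) + (b * a + (b + a) * y) := by
      linear_combination hb
    rw [this, pow_add, pow_mul]
    simp
  · simp

theorem Rdown_eq (m N k : ℕ) (u : ℂ) : Rdown m N k u
    = u • 1 + ∑ i : Fin k,
      permMat m (· < ·) (Equiv.swap (Fin.castAdd 1 i) (Fin.natAdd k (0 : Fin 1))) := by
  rw [Rdown]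
  congr 1
  rw [Finset.sum_congr rfl fun a _ => Finset.sum_comm, Finset.sum_comm]
  exact Finset.sum_congr rfl fun i _ => sum_embed_mul_embed m (by simp [Fin.lt_def])

theorem Rup_eq (m N k : ℕ) (u : ℂ) : Rup m N k u
    = (u + (k : ℂ) - 1) • 1 + ∑ i : Fin k,
      permMat m (· < ·) (Equiv.swap (Fin.castAdd k (0 : Fin 1)) (Fin.natAdd 1 i)) := by
  rw [Rup]
  congr 1
  rw [Finset.sum_congr rfl fun a _ => Finset.sum_comm, Finset.sum_comm]
  exact Finset.sum_congr rfl fun i _ => sum_embed_mul_embed m (by simp [Fin.lt_def])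

theorem fusedR_one_right_mul_projAL (m N k : ℕ) (u : ℂ) :
    fusedR m N (k + 1) 1 u * projAL m N (k + 1) 1
      = (∏ i ∈ Finset.Icc 1 k, (u - (i : ℂ))) •
        (Rdown m N (k + 1) u * projAL m N (k + 1) 1) := by
  have main := prod_smul_one_add_mul (projAL m N (k + 1) 1) (u - k) k
    (fun i => permMat m (· < ·)
      (Equiv.swap (Fin.castAdd 1 i.rev) (Fin.natAdd (k + 1) (0 : Fin 1))))
    (fun i j hij => permMat_swap_mul_swap_mul (by simpa using hij.symm)
      (by simp [Fin.ext_iff]; omega)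
      (permMat_swap_mul_projAL m N (by simpa using hij.symm)))
  have hfused : fusedR m N (k + 1) 1 u = ((List.finRange (k + 1)).map fun i : Fin (k + 1) =>
      (u - k + ((k : ℂ) - (i : ℕ))) • (1 : Matrix (Fin (k + 1 + 1) → Fin N) _ ℂ)
        + permMat m (· < ·)
          (Equiv.swap (Fin.castAdd 1 i.rev) (Fin.natAdd (k + 1) (0 : Fin 1)))).prod := by
    rw [fusedR, List.finRange_reverse, List.map_map]
    congr 1
    refine List.map_congr_left fun i _ => ?_
    have hi : ((i.rev : ℕ) : ℂ) = k - (i : ℕ) := by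
      rw [Fin.val_rev, Nat.cast_sub (by omega)]; push_cast; ring
    simp only [Function.comp_apply, List.finRange_succ, List.finRange_zero, List.map_cons,
      List.map_nil, List.prod_cons, List.prod_nil, mul_one, RMat, hi]
    congr 2
    push_cast [Fin.val_zero]
    ring
  have hsum := Equiv.sum_comp Fin.revPerm fun i : Fin (k + 1) =>
    (permMat m (· < ·) (Equiv.swap (Fin.castAdd 1 i) (Fin.natAdd (k + 1) (0 : Fin 1))) :
      Matrix (Fin (k + 1 + 1) → Fin N) (Fin (k + 1 + 1) → Fin N) ℂ)
  simp only [Fin.revPerm_apply] at hsum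
  have hprod : ∏ t ∈ Finset.range k, (u - k + (t : ℂ)) = ∏ i ∈ Finset.Icc 1 k, (u - (i : ℂ)) := by
    refine Finset.prod_nbij' (fun t => k - t) (fun i => k - i) ?_ ?_ ?_ ?_ ?_
    all_goals intro t ht; simp only [Finset.mem_range, Finset.mem_Icc] at ht ⊢
    any_goals omega
    rw [Nat.cast_sub ht.le]; ring
  rw [hfused, main, hsum, hprod, Rdown_eq, sub_add_cancel]

theorem fusedR_one_left_mul_projAR (m N k : ℕ) (u : ℂ) :
    fusedR m N 1 (k + 1) u * projAR m N 1 (k + 1)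
      = (∏ i ∈ Finset.range k, (u + (i : ℂ))) •
        (Rup m N (k + 1) u * projAR m N 1 (k + 1)) := by
  have main := prod_smul_one_add_mul (projAR m N 1 (k + 1)) u k
    (fun i => permMat m (· < ·)
      (Equiv.swap (Fin.castAdd (k + 1) (0 : Fin 1)) (Fin.natAdd 1 i)))
    (fun i j hij => by
      simp only [Equiv.swap_comm (Fin.castAdd (k + 1) (0 : Fin 1))]
      exact permMat_swap_mul_swap_mul (by simpa using hij.symm)
        (by rw [Ne, Fin.ext_iff, Fin.val_natAdd, Fin.val_castAdd]; omega)
        (permMat_swap_mul_projAR m N hij.symm))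
  have hfused : fusedR m N 1 (k + 1) u = ((List.finRange (k + 1)).map fun i : Fin (k + 1) =>
      (u + ((k : ℂ) - (i : ℕ))) • (1 : Matrix (Fin (1 + (k + 1)) → Fin N) _ ℂ)
        + permMat m (· < ·)
          (Equiv.swap (Fin.castAdd (k + 1) (0 : Fin 1)) (Fin.natAdd 1 i))).prod := by
    have h1 : List.finRange 1 = [0] := rfl
    simp only [fusedR, h1, List.map_nil, List.reverse_singleton, List.map_cons,
      List.prod_cons, List.prod_nil, mul_one, RMat]
    congr 1
    refine List.map_congr_left fun i _ => ?_
    congr 2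
    push_cast [Fin.val_zero]
    ring
  rw [hfused, main, Rup_eq]
  congr 4
  push_cast
  ring

theorem statement1 (m n k : ℕ) (hk : 1 ≤ k) : ∀ u : ℂ,
    (fusedR m (m + n) k 1 u * projAL m (m + n) k 1
      = (∏ i ∈ Finset.Icc 1 (k - 1), (u - (i : ℂ))) • (Rdown m (m + n) k u * projAL m (m + n) k 1))
    ∧ (fusedR m (m + n) 1 k u * projAR m (m + n) 1 k
      = (∏ i ∈ Finset.range (k - 1), (u + (i : ℂ))) • (Rup m (m + n) k u * projAR m (m + n) 1 k)) := by
  obtain ⟨k, rfl⟩ := Nat.exists_eq_add_of_le' hk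
  intro u
  exact ⟨fusedR_one_right_mul_projAL m (m + n) k u, fusedR_one_left_mul_projAR m (m + n) k u⟩

end Paper
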